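/- Let φ₀ ∈ ℝ^N be a nonzero vector with support W = {i : φ₀(i) ≠ 0}, and let H(φ₀) denote the principal graph shift-invariant space generated by φ₀. Then #W · dim H(φ₀) ≥ (‖U‖∞*)^{−2}, where ‖U‖∞* = sup{(#W' · #Ω')^{−1/2} : W', Ω' ⊆ {1, …, N} with Σ_{i ∈ W', n ∈ Ω'} |u_n(i)|² ≥ 1}. -/

import Mathlib

open Matrix

/-- `S^α = S 0 ^ α 0 * S 1 ^ α 1 * ⋯ * S (L-1) ^ α (L-1)`. -/
def Spow {N L : ℕ} (S : Fin L → Matrix (Fin N) (Fin N) ℝ) (α : Fin L → ℕ) :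
    Matrix (Fin N) (Fin N) ℝ :=
  (List.ofFn fun l => S l ^ α l).prod

/-- The principal graph shift-invariant space generated by `φ₀`. -/
def PGSIS {N L : ℕ} (S : Fin L → Matrix (Fin N) (Fin N) ℝ) (φ₀ : Fin N → ℝ) :
    Submodule ℝ (Fin N → ℝ) :=
  Submodule.span ℝ {v | ∃ α : Fin L → ℕ, v = Spow S α *ᵥ φ₀}

/-- The quantity `‖U‖∞* = sup {(#W' #Ω')^{-1/2} : ∑_{i ∈ W', n ∈ Ω'} |u_n(i)|² ≥ 1}`. -/
noncomputable def UnormStar {N : ℕ} (U : Matrix (Fin N) (Fin N) ℝ) : ℝ :=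
  sSup {r : ℝ | ∃ W' Ω' : Finset (Fin N),
    (1 : ℝ) ≤ ∑ i ∈ W', ∑ n ∈ Ω', (U i n) ^ 2 ∧
    r = (Real.sqrt ((W'.card : ℝ) * (Ω'.card : ℝ)))⁻¹}

/-- Orthogonal conjugation of diagonal matrices, as a monoid homomorphism. -/
def conjDiagonal {N : ℕ} (U : Matrix (Fin N) (Fin N) ℝ) (hU : Uᵀ * U = 1 ∧ U * Uᵀ = 1) :
    (Fin N → ℝ) →* Matrix (Fin N) (Fin N) ℝ where
  toFun d := U * diagonal d * Uᵀ
  map_one' := by simp [hU.2]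
  map_mul' d e := by
    calc U * diagonal (d * e) * Uᵀ = U * diagonal d * 1 * diagonal e * Uᵀ := by
          rw [Matrix.mul_one, Matrix.mul_assoc U (diagonal d), diagonal_mul_diagonal]; rfl
      _ = _ := by rw [← hU.1]; simp only [Matrix.mul_assoc]

theorem Spow_eq_conj_diagonal {N L : ℕ} (S : Fin L → Matrix (Fin N) (Fin N) ℝ)
    (U : Matrix (Fin N) (Fin N) ℝ) (lam : Fin L → Fin N → ℝ)
    (hU : Uᵀ * U = 1 ∧ U * Uᵀ = 1)
    (hdiag : ∀ l, S l = U * diagonal (lam l) * Uᵀ) (α : Fin L → ℕ) :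
    Spow S α = U * diagonal (fun n => ∏ l, lam l n ^ α l) * Uᵀ := by
  have hS : ∀ l, S l = conjDiagonal U hU (lam l) := hdiag
  have hlist : (List.ofFn fun l => S l ^ α l) =
      (List.ofFn fun l => lam l ^ α l).map (conjDiagonal U hU) := by
    rw [List.map_ofFn]
    congr 1
    funext l
    simp [hS]
  rw [Spow, hlist, ← map_list_prod, List.prod_ofFn]
  change U * diagonal _ * Uᵀ = _
  congr 3
  funext n
  simp

/-- Polynomial filters map the generator into the shift-invariant space. -/
theorem conj_diagonal_eval_mulVec_mem_PGSIS {N L : ℕ} (S : Fin L → Matrix (Fin N) (Fin N) ℝ)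
    (U : Matrix (Fin N) (Fin N) ℝ) (lam : Fin L → Fin N → ℝ)
    (hU : Uᵀ * U = 1 ∧ U * Uᵀ = 1)
    (hdiag : ∀ l, S l = U * diagonal (lam l) * Uᵀ) (φ₀ : Fin N → ℝ)
    (p : MvPolynomial (Fin L) ℝ) :
    (U * diagonal (fun n => p.eval fun l => lam l n) * Uᵀ) *ᵥ φ₀ ∈ PGSIS S φ₀ := by
  induction p using MvPolynomial.induction_on' with
  | monomial α c =>
    have hmem : Spow S α *ᵥ φ₀ ∈ PGSIS S φ₀ := Submodule.subset_span ⟨α, rfl⟩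
    convert (PGSIS S φ₀).smul_mem c hmem using 1
    rw [Spow_eq_conj_diagonal S U lam hU hdiag, ← smul_mulVec, ← Matrix.smul_mul, ← Matrix.mul_smul,
      ← diagonal_smul]
    congr 4
    funext n
    simp [MvPolynomial.eval_monomial, Finsupp.prod_fintype]
  | add p q hp hq =>
    convert (PGSIS S φ₀).add_mem hp hq using 1
    rw [← add_mulVec, ← add_mul, ← mul_add, diagonal_add]
    simp

/-- An eigenvector that occurs in the spectral expansion of the generator lies in the
shift-invariant space. -/
theorem col_mem_PGSIS {N L : ℕ} (S : Fin L → Matrix (Fin N) (Fin N) ℝ)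
    (U : Matrix (Fin N) (Fin N) ℝ) (lam : Fin L → Fin N → ℝ)
    (hU : Uᵀ * U = 1 ∧ U * Uᵀ = 1)
    (hdiag : ∀ l, S l = U * diagonal (lam l) * Uᵀ)
    (hspec : ∀ n m : Fin N, (∀ l, lam l n = lam l m) → n = m)
    (φ₀ : Fin N → ℝ) (n : Fin N) (hn : (Uᵀ *ᵥ φ₀) n ≠ 0) :
    Uᵀ n ∈ PGSIS S φ₀ := by
  have hsep : ∀ m, ∃ q : MvPolynomial (Fin L) ℝ,
      (q.eval fun l => lam l n) ≠ 0 ∧ (m ≠ n → (q.eval fun l => lam l m) = 0) := by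
    intro m
    by_cases hmn : m = n
    · exact ⟨1, by simp, fun h => absurd hmn h⟩
    · obtain ⟨l, hl⟩ : ∃ l, lam l n ≠ lam l m := by
        by_contra! h
        exact hmn (hspec n m h).symm
      exact ⟨MvPolynomial.X l - MvPolynomial.C (lam l m), by simpa [sub_eq_zero] using hl,
        fun _ => by simp⟩
  choose q hq using hsep
  set p := ∏ m, q m with hp
  have hpn : (p.eval fun l => lam l n) ≠ 0 := by
    rw [hp, map_prod]
    exact Finset.prod_ne_zero_iff.2 fun m _ => (hq m).1
  have hpm : ∀ m, m ≠ n → (p.eval fun l => lam l m) = 0 := fun m hm => by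
    rw [hp, map_prod]
    exact Finset.prod_eq_zero (Finset.mem_univ m) ((hq m).2 hm)
  have hmem := conj_diagonal_eval_mulVec_mem_PGSIS S U lam hU hdiag φ₀ p
  have hcol : (U * diagonal (fun m => p.eval fun l => lam l m) * Uᵀ) *ᵥ φ₀ =
      ((p.eval fun l => lam l n) * (Uᵀ *ᵥ φ₀) n) • Uᵀ n := by
    rw [← mulVec_mulVec, ← mulVec_mulVec]
    funext i
    rw [mulVec, dotProduct, Finset.sum_eq_single n]
    · simp [mulVec_diagonal]
      ring
    · intro m _ hm
      simp [mulVec_diagonal, hpm m hm]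
    · simp
  rw [hcol] at hmem
  exact ((PGSIS S φ₀).smul_mem_iff (mul_ne_zero hpn hn)).1 hmem

theorem card_spectral_support_le_finrank_PGSIS {N L : ℕ} (S : Fin L → Matrix (Fin N) (Fin N) ℝ)
    (U : Matrix (Fin N) (Fin N) ℝ) (lam : Fin L → Fin N → ℝ)
    (hU : Uᵀ * U = 1 ∧ U * Uᵀ = 1)
    (hdiag : ∀ l, S l = U * diagonal (lam l) * Uᵀ)
    (hspec : ∀ n m : Fin N, (∀ l, lam l n = lam l m) → n = m)
    (φ₀ : Fin N → ℝ) (Ω : Finset (Fin N)) (hΩ : ∀ n ∈ Ω, (Uᵀ *ᵥ φ₀) n ≠ 0) :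
    Ω.card ≤ Module.finrank ℝ (PGSIS S φ₀) := by
  have hli : LinearIndependent ℝ (fun n => Uᵀ n) :=
    linearIndependent_rows_of_isUnit (IsUnit.of_mul_eq_one U hU.1)
  have hliΩ : LinearIndependent ℝ (fun n : Ω => Uᵀ n) :=
    hli.comp _ Subtype.val_injective
  have hliH : LinearIndependent ℝ (fun n : Ω =>
      (⟨Uᵀ n, col_mem_PGSIS S U lam hU hdiag hspec φ₀ n (hΩ n n.2)⟩ : PGSIS S φ₀)) :=
    LinearIndependent.of_comp (PGSIS S φ₀).subtype hliΩ
  simpa using hliH.fintype_card_le_finrank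

/-- The rectangle spanned by the supports of a nonzero signal and of its transform carries at
least unit energy of an orthogonal matrix. -/
theorem one_le_sum_sq_supports {N : ℕ} (U : Matrix (Fin N) (Fin N) ℝ) (hU : U * Uᵀ = 1)
    (φ : Fin N → ℝ) (hφ : φ ≠ 0) (W Ω : Finset (Fin N))
    (hW : ∀ i, i ∉ W → φ i = 0) (hΩ : ∀ n, n ∉ Ω → (Uᵀ *ᵥ φ) n = 0) :
    (1 : ℝ) ≤ ∑ i ∈ W, ∑ n ∈ Ω, (U i n) ^ 2 := by
  have hpos : 0 < ∑ i ∈ W, φ i ^ 2 := by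
    obtain ⟨i, hi⟩ := Function.ne_iff.1 hφ
    exact Finset.sum_pos' (fun _ _ => sq_nonneg _)
      ⟨i, by_contra fun h => hi (hW i h), sq_pos_of_ne_zero hi⟩
  have hnorm : ∑ n ∈ Ω, (Uᵀ *ᵥ φ) n ^ 2 = ∑ i ∈ W, φ i ^ 2 := by
    rw [Finset.sum_subset (Finset.subset_univ Ω) fun n _ h => by rw [hΩ n h]; simp,
      Finset.sum_subset (Finset.subset_univ W) fun i _ h => by rw [hW i h]; simp]
    have h : (Uᵀ *ᵥ φ) ⬝ᵥ (Uᵀ *ᵥ φ) = φ ⬝ᵥ φ := by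
      rw [dotProduct_mulVec, vecMul_transpose, mulVec_mulVec, hU, one_mulVec]
    simpa [dotProduct, sq] using h
  have hbound : ∀ n ∈ Ω, (Uᵀ *ᵥ φ) n ^ 2 ≤ (∑ i ∈ W, U i n ^ 2) * ∑ i ∈ W, φ i ^ 2 := by
    intro n _
    have h : (Uᵀ *ᵥ φ) n = ∑ i ∈ W, U i n * φ i :=
      (Finset.sum_subset (Finset.subset_univ W) fun i _ h => by rw [hW i h]; simp).symm
    rw [h]
    exact Finset.sum_mul_sq_le_sq_mul_sq _ _ _
  have hsum := Finset.sum_le_sum hbound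
  rw [hnorm, ← Finset.sum_mul, Finset.sum_comm] at hsum
  exact (le_mul_iff_one_le_left hpos).1 hsum

theorem inv_UnormStar_sq_le {N : ℕ} (U : Matrix (Fin N) (Fin N) ℝ) (W Ω : Finset (Fin N))
    (h : (1 : ℝ) ≤ ∑ i ∈ W, ∑ n ∈ Ω, (U i n) ^ 2) :
    (UnormStar U ^ 2)⁻¹ ≤ (W.card : ℝ) * Ω.card := by
  have hW : W.Nonempty := by
    by_contra! hW
    norm_num [hW] at h
  have hΩ : Ω.Nonempty := by
    by_contra! hΩ
    norm_num [hΩ] at h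
  have hpos : (0 : ℝ) < W.card * Ω.card := by
    have := hW.card_pos
    have := hΩ.card_pos
    positivity
  have hbdd : BddAbove {r : ℝ | ∃ W' Ω' : Finset (Fin N),
      (1 : ℝ) ≤ ∑ i ∈ W', ∑ n ∈ Ω', (U i n) ^ 2 ∧
      r = (Real.sqrt ((W'.card : ℝ) * (Ω'.card : ℝ)))⁻¹} := by
    refine ((Set.finite_range fun P : Finset (Fin N) × Finset (Fin N) =>
      (Real.sqrt ((P.1.card : ℝ) * (P.2.card : ℝ)))⁻¹).subset ?_).bddAbove
    rintro r ⟨W', Ω', -, rfl⟩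
    exact ⟨(W', Ω'), rfl⟩
  have hle : (Real.sqrt ((W.card : ℝ) * Ω.card))⁻¹ ≤ UnormStar U :=
    le_csSup hbdd ⟨W, Ω, h, rfl⟩
  have hr : 0 < (Real.sqrt ((W.card : ℝ) * Ω.card))⁻¹ := by positivity
  calc (UnormStar U ^ 2)⁻¹ ≤ ((Real.sqrt ((W.card : ℝ) * Ω.card))⁻¹ ^ 2)⁻¹ := by gcongr
    _ = (W.card : ℝ) * Ω.card := by rw [inv_pow, inv_inv, Real.sq_sqrt hpos.le]

/-- Uncertainty principle: `#(supp φ₀) · dim H(φ₀) ≥ (‖U‖∞*)^{−2}`, so a principal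
graph shift-invariant space generated by a localized signal has large dimension. -/
theorem stmt12 {N L : ℕ} (hN : 1 ≤ N) (hL : 1 ≤ L)
    (S : Fin L → Matrix (Fin N) (Fin N) ℝ)
    (U : Matrix (Fin N) (Fin N) ℝ)
    (lam : Fin L → Fin N → ℝ)
    (hsymm : ∀ l, (S l)ᵀ = S l)
    (hcomm : ∀ l l', S l * S l' = S l' * S l)
    (hU : Uᵀ * U = 1 ∧ U * Uᵀ = 1)
    (hdiag : ∀ l, S l = U * Matrix.diagonal (lam l) * Uᵀ)
    (hspec : ∀ n m : Fin N, (∀ l, lam l n = lam l m) → n = m)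
    (φ₀ : Fin N → ℝ) (hφ₀ : φ₀ ≠ 0) :
    (UnormStar U ^ 2)⁻¹ ≤
      ({i : Fin N | φ₀ i ≠ 0}.ncard : ℝ) *
        (Module.finrank ℝ (PGSIS S φ₀) : ℝ) := by
  classical
  have hsupp := one_le_sum_sq_supports U hU.2 φ₀ hφ₀ {i | φ₀ i ≠ 0} {n | (Uᵀ *ᵥ φ₀) n ≠ 0}
    (by simp) (by simp)
  refine (inv_UnormStar_sq_le U _ _ hsupp).trans ?_
  have hdim := card_spectral_support_le_finrank_PGSIS S U lam hU hdiag hspec φ₀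
    {n | (Uᵀ *ᵥ φ₀) n ≠ 0} (by simp)
  rw [Set.ncard_eq_toFinset_card', Set.toFinset_ofPred]
  gcongr
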